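/- Conditional martingale property after a stopping time (Lemma 'stroock varadhan cond mg'): Fix t* ≥ 0, a Borel probability measure P on Ω, and a finite (𝓕_t)-stopping time τ with τ ≥ t*. Let M = (M_s)_{s≥0} be a real-valued right-continuous (𝓕_t)-adapted process such that (M_s − M_{s∧t*})_{s≥0} is a P-martingale with respect to (𝓕_t). Then there exists a P-null set N such that, for every ω ∉ N, the process (M_s − M_{s∧τ(ω)})_{s≥0} is a martingale with respect to (𝓕_t) under the measure P(·|𝓕_τ)(ω). -/

import Mathlib

open MeasureTheory Set Filter Topology
open scoped NNReal ENNReal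

noncomputable section

namespace NLSP

/-- Lebesgue measure on `ℝ≥0`, obtained from Lebesgue measure on `ℝ`. -/
def leb : Measure ℝ≥0 := (volume : Measure ℝ).comap Subtype.val

section PathSpace

variable {F : Type*} [TopologicalSpace F]

/-- The shift map `θ_t ω = ω (· + t)` on the path space `C(ℝ≥0, F)`. -/
def theta (t : ℝ≥0) (ω : C(ℝ≥0, F)) : C(ℝ≥0, F) :=
  ω.comp ⟨fun s => s + t, by fun_prop⟩

/-- The map `γ_t ω = ω ((· - t)⁺)` on the path space `C(ℝ≥0, F)`. -/
def gammaShift (t : ℝ≥0) (ω : C(ℝ≥0, F)) : C(ℝ≥0, F) :=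
  ω.comp ⟨fun s => s - t, by fun_prop⟩

/-- The canonical σ-algebra `𝓕_t = σ(X_s : s ≤ t)` on the path space. -/
def canonicalSig (F : Type*) [TopologicalSpace F] (t : ℝ≥0) :
    MeasurableSpace C(ℝ≥0, F) :=
  ⨆ s ∈ Set.Iic t, MeasurableSpace.comap (fun ω : C(ℝ≥0, F) => ω s) (borel F)

/-- The right-continuous σ-algebra `𝒢^t_s = ⋂_{r > s} σ(X_{v+t} : v ≤ r)` generated by the
shifted coordinate process. -/
def shiftSig (F : Type*) [TopologicalSpace F] (t s : ℝ≥0) :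
    MeasurableSpace C(ℝ≥0, F) :=
  ⨅ r ∈ Set.Ioi s, ⨆ v ∈ Set.Iic r,
    MeasurableSpace.comap (fun ω : C(ℝ≥0, F) => ω (v + t)) (borel F)

end PathSpace

/-- A function `ℝ≥0 → E` is càdlàg if it is right-continuous and has left limits. -/
def Cadlag {E : Type*} [TopologicalSpace E] (f : ℝ≥0 → E) : Prop :=
  (∀ t, ContinuousWithinAt f (Set.Ici t) t) ∧
    ∀ t : ℝ≥0, 0 < t → ∃ l : E, Tendsto f (nhdsWithin t (Set.Iio t)) (nhds l)

/-- A function is upper semianalytic if its strict superlevel sets are analytic. -/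
def UpperSemianalytic {α : Type*} [TopologicalSpace α] (ψ : α → ℝ) : Prop :=
  ∀ c : ℝ, MeasureTheory.AnalyticSet {x | c < ψ x}

section Mart

variable {Ω' : Type*}

/-- `τ` is a stopping time for the filtration `𝒢`. -/
def IsStoppingTimeOn (𝒢 : ℝ≥0 → MeasurableSpace Ω') (τ : Ω' → ℝ≥0) : Prop :=
  ∀ t, MeasurableSet[𝒢 t] {ω | τ ω ≤ t}

/-- `N` is a `P`-martingale for the filtration `𝒢`. -/
def IsMartingaleOn [MeasurableSpace Ω'] (P : Measure Ω')
    (𝒢 : ℝ≥0 → MeasurableSpace Ω') {E : Type*} [NormedAddCommGroup E] [NormedSpace ℝ E]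
    (N : ℝ≥0 → Ω' → E) : Prop :=
  (∀ s, StronglyMeasurable[𝒢 s] (N s)) ∧ (∀ s, Integrable (N s) P) ∧
    ∀ s t : ℝ≥0, s ≤ t → ∀ A : Set Ω', MeasurableSet[𝒢 s] A →
      ∫ ω in A, N t ω ∂P = ∫ ω in A, N s ω ∂P

/-- `N` is a local `P`-martingale for the filtration `𝒢`: there is a localizing
nondecreasing sequence of `𝒢`-stopping times increasing `P`-a.s. to `∞` such that every
stopped process is a `P`-martingale. -/
def IsLocalMartingaleOn [MeasurableSpace Ω'] (P : Measure Ω')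
    (𝒢 : ℝ≥0 → MeasurableSpace Ω') {E : Type*} [NormedAddCommGroup E] [NormedSpace ℝ E]
    (N : ℝ≥0 → Ω' → E) : Prop :=
  ∃ σ : ℕ → Ω' → ℝ≥0,
    (∀ n, IsStoppingTimeOn 𝒢 (σ n)) ∧ (∀ n ω, σ n ω ≤ σ (n + 1) ω) ∧
      (∀ᵐ ω ∂P, Tendsto (fun n => σ n ω) atTop atTop) ∧
      ∀ n, IsMartingaleOn P 𝒢 fun s ω => N (min s (σ n ω)) ω

/-- Progressive measurability of `a` with respect to the filtration `𝒢`. -/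
def ProgMeasOn (𝒢 : ℝ≥0 → MeasurableSpace Ω') {E : Type*} [MeasurableSpace E]
    (a : ℝ≥0 → Ω' → E) : Prop :=
  ∀ s : ℝ≥0,
    @Measurable (ℝ≥0 × Ω') E ((inferInstance : MeasurableSpace ℝ≥0).prod (𝒢 s)) _
      fun p => a (min p.1 s) p.2

end Mart

section Main

variable {F : Type*} [TopologicalSpace F] {𝕂 : Type*} [RCLike 𝕂]
  [MeasurableSpace 𝕂] {U : Type*}

/-- The set `𝒞(t, ω)` of laws under which every test process `Y^u` is a special semimartingale
(after time `t`) with absolutely continuous compensator whose densities lie in `Θ`. -/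
def CSet [MeasurableSpace C(ℝ≥0, F)] (Y : U → ℝ≥0 → C(ℝ≥0, F) → 𝕂)
    (Θ : ℝ≥0 → C(ℝ≥0, F) → Set (U → 𝕂)) (t : ℝ≥0) (ω : C(ℝ≥0, F)) :
    Set (ProbabilityMeasure C(ℝ≥0, F)) :=
  {P | (P : Measure C(ℝ≥0, F)) {ω' | ∀ s ≤ t, ω' s = ω s} = 1 ∧
    ∃ a : U → ℝ≥0 → C(ℝ≥0, F) → 𝕂,
      (∀ u, ProgMeasOn (shiftSig F t) (a u)) ∧
      (∀ u, ∀ᵐ ω' ∂(P : Measure C(ℝ≥0, F)), ∀ s : ℝ≥0,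
        IntegrableOn (fun r => a u r ω') (Set.Iic s) leb) ∧
      (∀ u, IsLocalMartingaleOn (P : Measure C(ℝ≥0, F)) (shiftSig F t)
        fun s ω' => Y u (s + t) ω' - Y u t ω' - ∫ r in Set.Iic s, a u r ω' ∂leb) ∧
      ∀ᵐ p ∂(leb.prod (P : Measure C(ℝ≥0, F))),
        (fun u => a u p.1 p.2) ∈ Θ (p.1 + t) p.2}

/-- The set `ℛ(x) = 𝒞(0, x)` for the Markovian specification `Θ(t, ω) = Θ₀(ω t)`. -/
def RSet [MeasurableSpace C(ℝ≥0, F)] (Y : U → ℝ≥0 → C(ℝ≥0, F) → 𝕂)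
    (Θ₀ : F → Set (U → 𝕂)) (x : F) : Set (ProbabilityMeasure C(ℝ≥0, F)) :=
  CSet Y (fun s ω' => Θ₀ (ω' s)) 0 (ContinuousMap.const ℝ≥0 x)

/-- The set `𝒦(t, x)` for the Markovian specification `Θ(t, ω) = Θ₀(ω t)`. -/
def KSet [MeasurableSpace C(ℝ≥0, F)] (Y : U → ℝ≥0 → C(ℝ≥0, F) → 𝕂)
    (Θ₀ : F → Set (U → 𝕂)) (t : ℝ≥0) (x : F) : Set (ProbabilityMeasure C(ℝ≥0, F)) :=
  CSet Y (fun s ω' => Θ₀ (ω' s)) t (ContinuousMap.const ℝ≥0 x)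

end Main

end NLSP

namespace NLSP

section Conditioning

variable {F : Type*} [TopologicalSpace F]

open Classical in
/-- Concatenation `ω ⊗_t ω'` of two paths: if `ω'(t) = ω(t)` it follows `ω` until time `t`
and `ω'` afterwards; otherwise it is the stopped path `ω(· ∧ t)` (immaterial convention). -/
def concat (t : ℝ≥0) (ω ω' : C(ℝ≥0, F)) : C(ℝ≥0, F) :=
  if h : ω' t = ω t then
    ⟨fun s => if s ≤ t then ω s else ω' s,
      Continuous.if_le ω.continuous ω'.continuous continuous_id continuous_const
        fun s hs => by rw [hs, h]⟩
  else ω.comp ⟨fun s => min s t, by fun_prop⟩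

/-- The σ-algebra `𝓕_τ` of a stopping time `τ` (for a stopping time, the generating family
below is already a σ-algebra). -/
def ftau [MeasurableSpace C(ℝ≥0, F)] (τ : C(ℝ≥0, F) → ℝ≥0) :
    MeasurableSpace C(ℝ≥0, F) :=
  MeasurableSpace.generateFrom
    {A | MeasurableSet A ∧ ∀ t, MeasurableSet[canonicalSig F t] (A ∩ {ω | τ ω ≤ t})}

/-- `κ` is a regular conditional probability of `P` given `𝓕_τ`. -/
def IsRCP [MeasurableSpace C(ℝ≥0, F)] (P : Measure C(ℝ≥0, F)) (τ : C(ℝ≥0, F) → ℝ≥0)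
    (κ : C(ℝ≥0, F) → Measure C(ℝ≥0, F)) : Prop :=
  (∀ ω, IsProbabilityMeasure (κ ω)) ∧
    (∀ A : Set C(ℝ≥0, F), MeasurableSet A →
      @Measurable _ _ (ftau τ) _ fun ω => κ ω A) ∧
    ∀ A B : Set C(ℝ≥0, F), MeasurableSet A → MeasurableSet[ftau τ] B →
      P (A ∩ B) = ∫⁻ ω in B, κ ω A ∂P

/-- The pasting measure `P ⊗_τ Q`. -/
def pasting [MeasurableSpace C(ℝ≥0, F)] (P : Measure C(ℝ≥0, F)) (τ : C(ℝ≥0, F) → ℝ≥0)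
    (Q : C(ℝ≥0, F) → Measure C(ℝ≥0, F)) : Measure C(ℝ≥0, F) :=
  P.bind fun ω => (Q ω).map fun ω' => concat (τ ω) ω ω'

end Conditioning

end NLSP


namespace NLSP

theorem L1_lim {Ω : Type*} {m0 : MeasurableSpace Ω} {μ : Measure Ω} [IsProbabilityMeasure μ]
    {m : ℕ → MeasurableSpace Ω} (hm : ∀ n, m n ≤ m0) {g : Ω → ℝ} (hg : Integrable g μ)
    {f : ℕ → Ω → ℝ} {f' : Ω → ℝ} (hf : ∀ n, f n =ᵐ[μ] μ[g | m n])
    (hlim : ∀ᵐ ω ∂μ, Tendsto (fun n => f n ω) atTop (𝓝 (f' ω))) :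
    Integrable f' μ ∧ ∀ A : Set Ω,
      Tendsto (fun n => ∫ ω in A, f n ω ∂μ) atTop (𝓝 (∫ ω in A, f' ω ∂μ)) := by
  have hUI : UniformIntegrable f 1 μ :=
    (hg.uniformIntegrable_condExp hm).ae_eq fun n => (hf n).symm
  have hL : MemLp f' 1 μ := hUI.memLp_of_ae_tendsto hlim
  refine ⟨memLp_one_iff_integrable.1 hL, fun A => ?_⟩
  refine tendsto_setIntegral_of_L1' f' hL.1 (Eventually.of_forall fun n => ?_) ?_ A
  · exact integrable_condExp.congr (hf n).symm
  · exact tendsto_Lp_finite_of_tendsto_ae le_rfl ENNReal.one_ne_top hUI.1 hL hUI.2.1 hlim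

theorem opt_stop {Ω : Type*} {m0 : MeasurableSpace Ω} {μ : Measure Ω} [IsProbabilityMeasure μ]
    (𝒢 : Filtration ℝ≥0 m0) (Y : ℝ≥0 → Ω → ℝ) (hY : Martingale Y 𝒢 μ)
    (hrc : ∀ ω s, ContinuousWithinAt (fun r => Y r ω) (Set.Ici s) s)
    (τ : Ω → ℝ≥0) (hτ : ∀ t, MeasurableSet[𝒢 t] {ω | τ ω ≤ t}) (t : ℝ≥0) :
    Measurable (fun ω => Y (min t (τ ω)) ω) ∧ Integrable (fun ω => Y (min t (τ ω)) ω) μ ∧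
    ∀ C : Set Ω, (∀ u, MeasurableSet[𝒢 u] (C ∩ {ω | τ ω ≤ u})) →
      ∫ ω in C ∩ {ω | τ ω ≤ t}, Y t ω ∂μ
        = ∫ ω in C ∩ {ω | τ ω ≤ t}, Y (min t (τ ω)) ω ∂μ := by
  have hτm : Measurable τ := measurable_of_Iic fun u => 𝒢.le u _ (hτ u)
  have hτlt : ∀ u, MeasurableSet[𝒢 u] {ω | τ ω < u} := by
    intro u
    by_cases hu : u = 0
    · simp [hu]
    have hu' : 0 < u := pos_iff_ne_zero.2 hu
    obtain ⟨v, _, hv, hvt⟩ := exists_seq_strictMono_tendsto' hu'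
    have : {ω | τ ω < u} = ⋃ n, {ω | τ ω ≤ v n} := by
      ext ω
      simp only [mem_ofPred_eq, mem_iUnion]
      constructor
      · intro h
        obtain ⟨n, hn⟩ := ((tendsto_order.1 hvt).1 _ h).exists
        exact ⟨n, hn.le⟩
      · rintro ⟨n, hn⟩
        exact hn.trans_lt (hv n).2
    rw [this]
    exact MeasurableSet.iUnion fun n => 𝒢.mono (hv n).2.le _ (hτ (v n))
  obtain ⟨k, hk⟩ : ∃ k : ℕ → Ω → ℕ, ∀ n ω, k n ω = ⌊((n : ℝ≥0) + 1) * τ ω⌋₊ :=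
    ⟨_, fun _ _ => rfl⟩
  obtain ⟨g, hg⟩ : ∃ g : ℕ → ℕ → ℝ≥0, ∀ n j, g n j = min (((j : ℝ≥0) + 1) / ((n : ℝ≥0) + 1)) t :=
    ⟨_, fun _ _ => rfl⟩
  have hkm : ∀ n, Measurable (k n) := fun n => by
    rw [show k n = fun ω => _ from funext (hk n)]
    exact Nat.measurable_floor.comp (hτm.const_mul _)
  obtain ⟨σ, hσ⟩ : ∃ σ : ℕ → Ω → ℝ≥0, ∀ n ω, σ n ω = g n (k n ω) := ⟨_, fun _ _ => rfl⟩
  have hnpos : ∀ n : ℕ, (0 : ℝ≥0) < (n : ℝ≥0) + 1 := fun n => by positivity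
  have hlow : ∀ n ω, τ ω < ((k n ω : ℝ≥0) + 1) / ((n : ℝ≥0) + 1) := by
    intro n ω
    rw [lt_div_iff₀ (hnpos n), mul_comm]
    rw [hk]; exact Nat.lt_floor_add_one _
  have hup : ∀ n ω, ((k n ω : ℝ≥0) + 1) / ((n : ℝ≥0) + 1) ≤ τ ω + 1 / ((n : ℝ≥0) + 1) := by
    intro n ω
    rw [add_div]
    gcongr
    rw [div_le_iff₀ (hnpos n), mul_comm, hk]
    exact Nat.floor_le (zero_le)
  have hσge : ∀ n ω, min t (τ ω) ≤ σ n ω := fun n ω => by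
    rw [min_comm, hσ, hg]; exact min_le_min_right _ (hlow n ω).le
  have hσlim : ∀ ω, Tendsto (fun n => σ n ω) atTop (𝓝 (min t (τ ω))) := by
    intro ω
    rw [min_comm]
    simp only [hσ, hg]
    refine Tendsto.min ?_ tendsto_const_nhds
    refine tendsto_of_tendsto_of_tendsto_of_le_of_le tendsto_const_nhds ?_
      (fun n => (hlow n ω).le) (fun n => hup n ω)
    have : Tendsto (fun n : ℕ => 1 / ((n : ℝ≥0) + 1)) atTop (𝓝 0) :=
      tendsto_one_div_add_atTop_nhds_zero_nat
    simpa using tendsto_const_nhds.add this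
  have hσle : ∀ n ω, σ n ω ≤ t := fun n ω => by rw [hσ, hg]; exact min_le_right _ _
  have hσst : ∀ n u, MeasurableSet[𝒢 u] {ω | σ n ω ≤ u} := by
    intro n u
    by_cases hu : t ≤ u
    · have : {ω | σ n ω ≤ u} = univ := by ext ω; simp [(hσle n ω).trans hu]
      rw [this]; exact MeasurableSet.univ
    have : {ω | σ n ω ≤ u}
        = {ω | τ ω < (⌊((n : ℝ≥0) + 1) * u⌋₊ : ℝ≥0) / ((n : ℝ≥0) + 1)} := by
      ext ω
      simp only [mem_ofPred_eq, hσ, hg, min_le_iff, hu, or_false]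
      rw [div_le_iff₀ (hnpos n), lt_div_iff₀ (hnpos n), mul_comm u, mul_comm (τ ω)]
      rw [← Nat.floor_lt zero_le, ← Nat.add_one_le_iff, Nat.le_floor_iff zero_le]
      simp [hk]
    rw [this]
    refine 𝒢.mono ?_ _ (hτlt _)
    rw [div_le_iff₀ (hnpos n), mul_comm u]
    exact Nat.floor_le zero_le
  have hst : ∀ n, IsStoppingTime 𝒢 (fun ω => ((σ n ω : ℝ≥0) : WithTop ℝ≥0)) := by
    intro n u
    have h := hσst n u
    have he : {ω | ((σ n ω : ℝ≥0) : WithTop ℝ≥0) ≤ (u : WithTop ℝ≥0)} = {ω | σ n ω ≤ u} := by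
      ext ω; exact WithTop.coe_le_coe
    rw [he]; exact h
  have hsle : ∀ n ω, ((σ n ω : ℝ≥0) : WithTop ℝ≥0) ≤ (t : WithTop ℝ≥0) := by
    intro n ω; exact_mod_cast hσle n ω
  have hcr : ∀ n, (Set.range (fun ω => ((σ n ω : ℝ≥0) : WithTop ℝ≥0))).Countable := by
    intro n
    refine (Set.countable_range (fun j : ℕ => ((g n j : ℝ≥0) : WithTop ℝ≥0))).mono ?_
    rintro _ ⟨ω, rfl⟩
    exact ⟨k n ω, by simp only [hσ]⟩
  have hce : ∀ n, (fun ω => Y (σ n ω) ω) =ᵐ[μ] μ[Y t | (hst n).measurableSpace] := by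
    intro n
    have := hY.stoppedValue_ae_eq_condExp_of_le_const_of_countable_range (hst n) (hsle n) (hcr n)
    exact this
  have hms : ∀ n, (hst n).measurableSpace ≤ m0 := fun n => (hst n).measurableSpace_le
  have hYlim : ∀ ω, Tendsto (fun n => Y (σ n ω) ω) atTop (𝓝 (Y (min t (τ ω)) ω)) := by
    intro ω
    refine (hrc ω (min t (τ ω))).tendsto.comp (tendsto_nhdsWithin_iff.2 ⟨hσlim ω, ?_⟩)
    exact Eventually.of_forall fun n => hσge n ω
  have hYm : ∀ n, Measurable (fun ω => Y (σ n ω) ω) := by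
    intro n
    have h1 : Measurable (fun p : ℕ × Ω => Y (g n p.1) p.2) :=
      measurable_from_prod_countable_right fun j =>
        ((hY.1 (g n j)).measurable.mono (𝒢.le _) le_rfl)
    simp only [hσ]
    exact h1.comp ((hkm n).prodMk measurable_id)
  obtain ⟨hI, hT⟩ := L1_lim hms (hY.integrable t) hce (Eventually.of_forall hYlim)
  refine ⟨measurable_of_tendsto_metrizable hYm (tendsto_pi_nhds.2 hYlim), hI, fun C hC => ?_⟩
  refine tendsto_nhds_unique ?_ (hT (C ∩ {ω | τ ω ≤ t}))
  refine tendsto_const_nhds.congr fun n => ?_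
  have hCm : MeasurableSet[(hst n).measurableSpace] (C ∩ {ω | τ ω ≤ t}) := by
    refine ⟨le_iSup (fun u => (𝒢 u : MeasurableSpace Ω)) t _ (hC t), fun u => ?_⟩
    have hst' : MeasurableSet[𝒢 u] {ω | ((σ n ω : ℝ≥0) : WithTop ℝ≥0) ≤ (u : WithTop ℝ≥0)} :=
      hst n u
    by_cases hu : t ≤ u
    · exact (𝒢.mono hu _ (hC t)).inter hst'
    · have : C ∩ {ω | τ ω ≤ t} ∩ {ω | ((σ n ω : ℝ≥0) : WithTop ℝ≥0) ≤ (u : WithTop ℝ≥0)}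
          = (C ∩ {ω | τ ω ≤ u}) ∩
            {ω | ((σ n ω : ℝ≥0) : WithTop ℝ≥0) ≤ (u : WithTop ℝ≥0)} := by
        ext ω
        simp only [mem_inter_iff, mem_ofPred_eq, WithTop.coe_le_coe]
        constructor
        · rintro ⟨⟨h1, h2⟩, h3⟩
          refine ⟨⟨h1, ?_⟩, h3⟩
          have := (hσge n ω).trans h3
          rwa [min_eq_right h2] at this
        · rintro ⟨⟨h1, h2⟩, h3⟩
          exact ⟨⟨h1, h2.trans (not_le.1 hu).le⟩, h3⟩
      rw [this]
      exact (hC u).inter hst'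
  rw [setIntegral_congr_ae (g := μ[Y t | (hst n).measurableSpace]) (hms n _ hCm)
    ((hce n).mono fun ω h _ => h), setIntegral_condExp (hms n) (hY.integrable t) hCm]

end NLSP

namespace NLSP

open scoped ProbabilityTheory

theorem cond_incr {Ω : Type*} {m0 : MeasurableSpace Ω} {μ : Measure Ω} [IsProbabilityMeasure μ]
    (𝒢 : Filtration ℝ≥0 m0) (Y : ℝ≥0 → Ω → ℝ) (hY : Martingale Y 𝒢 μ)
    (hrc : ∀ ω s, ContinuousWithinAt (fun r => Y r ω) (Set.Ici s) s)
    (τ : Ω → ℝ≥0) (hτ : ∀ t, MeasurableSet[𝒢 t] {ω | τ ω ≤ t}) (s t : ℝ≥0) (hst : s ≤ t)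
    (A B : Set Ω) (hA : MeasurableSet[𝒢 s] A) (hB : MeasurableSet B)
    (hB' : ∀ u, MeasurableSet[𝒢 u] (B ∩ {ω | τ ω ≤ u})) :
    ∫ ω in A ∩ B, (Y t ω - Y (min t (τ ω)) ω) ∂μ
      = ∫ ω in A ∩ B, (Y s ω - Y (min s (τ ω)) ω) ∂μ := by
  obtain ⟨-, hIt, hOt⟩ := opt_stop 𝒢 Y hY hrc τ hτ t
  obtain ⟨-, hIs, -⟩ := opt_stop 𝒢 Y hY hrc τ hτ s
  have hAm : MeasurableSet A := 𝒢.le _ _ hA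
  have hE : MeasurableSet {ω | τ ω ≤ s} := 𝒢.le _ _ (hτ s)
  have hEt : MeasurableSet {ω | τ ω ≤ t} := 𝒢.le _ _ (hτ t)
  have hDt := (hY.integrable t).sub hIt
  have hDs := (hY.integrable s).sub hIs
  have hC : MeasurableSet[𝒢 s] (A ∩ B ∩ {ω | τ ω ≤ s}) := by
    rw [inter_assoc]; exact hA.inter (hB' s)
  have e1 : ∫ ω in A ∩ B ∩ {ω | τ ω ≤ s}, (Y t ω - Y (min t (τ ω)) ω) ∂μ
      = ∫ ω in A ∩ B ∩ {ω | τ ω ≤ s}, (Y s ω - Y (min s (τ ω)) ω) ∂μ := by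
    rw [integral_sub (hY.integrable t).integrableOn hIt.integrableOn,
      integral_sub (hY.integrable s).integrableOn hIs.integrableOn,
      hY.setIntegral_eq hst hC]
    congr 1
    refine setIntegral_congr_fun (𝒢.le _ _ hC) fun ω hω => ?_
    have : τ ω ≤ s := hω.2
    simp only [min_eq_right this, min_eq_right (this.trans hst)]
  have e2 : ∫ ω in A ∩ B ∩ {ω | τ ω ≤ s}ᶜ, (Y s ω - Y (min s (τ ω)) ω) ∂μ = 0 := by
    refine setIntegral_eq_zero_of_forall_eq_zero fun ω hω => ?_
    have : s < τ ω := not_le.1 hω.2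
    simp [min_eq_left this.le]
  have e3 : ∫ ω in A ∩ B ∩ {ω | τ ω ≤ s}ᶜ, (Y t ω - Y (min t (τ ω)) ω) ∂μ = 0 := by
    have h1 : ∫ ω in A ∩ B ∩ {ω | τ ω ≤ s}ᶜ ∩ {ω | τ ω ≤ t}, (Y t ω - Y (min t (τ ω)) ω) ∂μ
        = 0 := by
      rw [integral_sub (hY.integrable t).integrableOn hIt.integrableOn, sub_eq_zero]
      refine hOt _ fun u => ?_
      by_cases hu : u ≤ s
      · have : A ∩ B ∩ {ω | τ ω ≤ s}ᶜ ∩ {ω | τ ω ≤ u} = ∅ := by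
          ext ω
          simp only [mem_inter_iff, mem_compl_iff, mem_ofPred_eq, mem_empty_iff_false, iff_false]
          rintro ⟨⟨_, h1⟩, h2⟩
          exact h1 (h2.trans hu)
        rw [this]; exact @MeasurableSet.empty _ (𝒢 u)
      · have hu' := (not_le.1 hu).le
        have : A ∩ B ∩ {ω | τ ω ≤ s}ᶜ ∩ {ω | τ ω ≤ u}
            = A ∩ {ω | τ ω ≤ s}ᶜ ∩ (B ∩ {ω | τ ω ≤ u}) := by
          ext ω; simp only [mem_inter_iff]; tauto
        rw [this]
        exact @MeasurableSet.inter _ (𝒢 u) _ _ (@MeasurableSet.inter _ (𝒢 u) _ _ (𝒢.mono hu' _ hA)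
          (@MeasurableSet.compl _ _ (𝒢 u) (𝒢.mono hu' _ (hτ s)))) (hB' u)
    have h2 : ∫ ω in A ∩ B ∩ {ω | τ ω ≤ s}ᶜ ∩ {ω | τ ω ≤ t}ᶜ, (Y t ω - Y (min t (τ ω)) ω) ∂μ
        = 0 := by
      refine setIntegral_eq_zero_of_forall_eq_zero fun ω hω => ?_
      have : t < τ ω := not_le.1 hω.2
      simp [min_eq_left this.le]
    have f := integral_inter_add_sdiff (s := A ∩ B ∩ {ω | τ ω ≤ s}ᶜ) hEt hDt.integrableOn
    rw [Set.sdiff_eq] at f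
    simp only [Pi.sub_apply] at f
    rw [← f, h1, h2, add_zero]
  have f1 := integral_inter_add_sdiff (s := A ∩ B) hE hDt.integrableOn
  have f2 := integral_inter_add_sdiff (s := A ∩ B) hE hDs.integrableOn
  rw [Set.sdiff_eq] at f1 f2
  simp only [Pi.sub_apply] at f1 f2
  rw [← f1, ← f2, e1, e2, e3]

theorem zero_on_sigma {Ω : Type*} {m0 : MeasurableSpace Ω} {ν : Measure Ω}
    {m : MeasurableSpace Ω} (hm : m ≤ m0) {b : Set (Set Ω)} (hb : m = MeasurableSpace.generateFrom b)
    (hpi : IsPiSystem b) (huniv : univ ∈ b) {h : Ω → ℝ} (hh : Integrable h ν)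
    (hz : ∀ A ∈ b, ∫ ω in A, h ω ∂ν = 0) (A : Set Ω) (hA : MeasurableSet[m] A) :
    ∫ ω in A, h ω ∂ν = 0 := by
  induction A, hA using MeasurableSpace.induction_on_inter hb hpi with
  | empty => simp
  | basic t ht => exact hz t ht
  | compl t htm ih =>
    have h1 := integral_add_compl (hm _ htm) hh
    have h2 := hz _ huniv
    rw [setIntegral_univ] at h2
    linarith
  | iUnion f hd hfm ih =>
    rw [integral_iUnion (fun i => hm _ (hfm i)) hd hh.integrableOn]
    simp [ih]

theorem rcp_aux {Ω : Type*} {m m0 : MeasurableSpace Ω} {P : Measure Ω} [IsProbabilityMeasure P]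
    (hm : m ≤ m0) (κ : Ω → Measure Ω)
    (hp : ∀ ω, IsProbabilityMeasure (κ ω))
    (hmeas : ∀ A, MeasurableSet A → Measurable[m] fun ω => κ ω A)
    (hdis : ∀ A B : Set Ω, MeasurableSet A → MeasurableSet[m] B →
      P (A ∩ B) = ∫⁻ ω in B, κ ω A ∂P) (f : Ω → ℝ) (hf : StronglyMeasurable f)
    (hfi : Integrable f P) :
    (∀ᵐ ω ∂P, Integrable f (κ ω)) ∧
    ((∀ B, MeasurableSet[m] B → ∫ ω in B, f ω ∂P = 0) → ∀ᵐ ω ∂P, ∫ ω', f ω' ∂(κ ω) = 0) := by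
  let K : @ProbabilityTheory.Kernel Ω Ω m m0 :=
    @ProbabilityTheory.Kernel.mk Ω Ω m m0 κ
      (@Measure.measurable_of_measurable_coe Ω Ω m0 m κ hmeas)
  let K0 : ProbabilityTheory.Kernel Ω Ω :=
    ⟨κ, Measure.measurable_of_measurable_coe κ fun A hA => (hmeas A hA).mono hm le_rfl⟩
  have hKM : @ProbabilityTheory.IsMarkovKernel Ω Ω m m0 K := @ProbabilityTheory.IsMarkovKernel.mk Ω Ω m m0 K hp
  have hK0M : ProbabilityTheory.IsMarkovKernel K0 := ⟨hp⟩
  have hbind : ∀ B, MeasurableSet[m] B →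
      (K0 ∘ₖ ProbabilityTheory.Kernel.const Unit (P.restrict B)) () = P.restrict B := by
    intro B hB
    ext A hA
    rw [ProbabilityTheory.Kernel.comp_apply' _ _ _ hA, Measure.restrict_apply hA, hdis A B hA hB]
    rfl
  have hint : ∀ B, MeasurableSet[m] B →
      Integrable f ((K0 ∘ₖ ProbabilityTheory.Kernel.const Unit (P.restrict B)) ()) := by
    intro B hB
    rw [hbind B hB]
    exact hfi.integrableOn
  constructor
  · have := (hint univ MeasurableSet.univ).ae_of_comp
    simpa using! this
  · intro hz
    have hsm : StronglyMeasurable[m] (fun ω => ∫ ω', f ω' ∂(κ ω)) :=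
      StronglyMeasurable.integral_kernel (κ := K) hf
    have hI : Integrable (fun ω => ∫ ω', f ω' ∂(κ ω)) P := by
      have := (hint univ MeasurableSet.univ).integral_comp
      simpa using! this
    refine ae_eq_of_forall_setIntegral_eq_of_sigmaFinite' (g := fun _ => (0 : ℝ)) hm
      (fun _ _ _ => hI.integrableOn) (fun _ _ _ => integrableOn_zero) (fun B hB _ => ?_)
      hsm.aestronglyMeasurable stronglyMeasurable_const.aestronglyMeasurable
    have := ProbabilityTheory.Kernel.integral_comp (hint B hB)
    rw [hbind B hB, hz B hB] at this
    simpa using! this.symm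

theorem tau_const {Ω : Type*} {m m0 : MeasurableSpace Ω} {P : Measure Ω} [IsProbabilityMeasure P]
    (hm : m ≤ m0) (κ : Ω → Measure Ω)
    (hmeas : ∀ A, MeasurableSet A → Measurable[m] fun ω => κ ω A)
    (hdis : ∀ A B : Set Ω, MeasurableSet A → MeasurableSet[m] B →
      P (A ∩ B) = ∫⁻ ω in B, κ ω A ∂P) (τ : Ω → ℝ≥0)
    (hτ : ∀ t, MeasurableSet[m] {ω | τ ω ≤ t}) (D : Set ℝ≥0) (hD : D.Countable) (hDd : Dense D) :
    ∀ᵐ ω ∂P, ∀ᵐ ω' ∂(κ ω), τ ω' = τ ω := by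
  have key : ∀ A, MeasurableSet[m] A → ∀ᵐ ω ∂P, ω ∉ A → κ ω A = 0 := by
    intro A hA
    have h1 := hdis A Aᶜ (hm _ hA) hA.compl
    rw [inter_compl_self, measure_empty] at h1
    have h2 := (lintegral_eq_zero_iff ((hmeas A (hm _ hA)).mono hm le_rfl)).1 h1.symm
    exact (ae_restrict_iff' (hm _ hA.compl)).1 h2
  have hall : ∀ᵐ ω ∂P, ∀ q ∈ D, (¬ τ ω ≤ q → κ ω {ω' | τ ω' ≤ q} = 0) ∧
      (τ ω ≤ q → κ ω {ω' | τ ω' ≤ q}ᶜ = 0) := by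
    rw [ae_ball_iff hD]
    intro q _
    filter_upwards [key _ (hτ q), key _ (hτ q).compl] with ω h1 h2
    exact ⟨h1, fun h => h2 (not_not.2 h)⟩
  filter_upwards [hall] with ω hω
  have : ∀ᵐ ω' ∂(κ ω), ∀ q ∈ D, (τ ω ≤ q ↔ τ ω' ≤ q) := by
    rw [ae_ball_iff hD]
    intro q hq
    by_cases h : τ ω ≤ q
    · have := (hω q hq).2 h
      filter_upwards [measure_eq_zero_iff_ae_notMem.1 this] with ω' h'
      exact ⟨fun _ => not_not.1 h', fun _ => h⟩
    · have := (hω q hq).1 h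
      filter_upwards [measure_eq_zero_iff_ae_notMem.1 this] with ω' h'
      exact ⟨fun h'' => absurd h'' h, fun h'' => absurd h'' h'⟩
  filter_upwards [this] with ω' h
  rcases lt_trichotomy (τ ω') (τ ω) with hlt | heq | hlt
  · obtain ⟨q, hq, h1, h2⟩ := hDd.exists_between hlt
    exact absurd ((h q hq).2 h1.le) (not_le.2 h2)
  · exact heq
  · obtain ⟨q, hq, h1, h2⟩ := hDd.exists_between hlt
    exact absurd ((h q hq).1 h1.le) (not_le.2 h2)

theorem mart_of_dense {Ω : Type*} {m0 : MeasurableSpace Ω} (Q : Measure Ω) [IsProbabilityMeasure Q]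
    (𝒢 : Filtration ℝ≥0 m0) (Z : ℝ≥0 → Ω → ℝ) (hZ : ∀ s, StronglyMeasurable[𝒢 s] (Z s))
    (hrc : ∀ ω s, ContinuousWithinAt (fun r => Z r ω) (Set.Ici s) s)
    (D : Set ℝ≥0) (hDd : Dense D) (hint : ∀ q ∈ D, Integrable (Z q) Q)
    (hm : ∀ s ∈ D, ∀ t ∈ D, s ≤ t → ∀ A, MeasurableSet[𝒢 s] A →
      ∫ ω in A, Z t ω ∂Q = ∫ ω in A, Z s ω ∂Q) :
    IsMartingaleOn Q (fun s => 𝒢 s) Z := by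
  have key : ∀ s, ∀ T ∈ D, s < T → Integrable (Z s) Q ∧ ∀ A, MeasurableSet[𝒢 s] A →
      ∫ ω in A, Z T ω ∂Q = ∫ ω in A, Z s ω ∂Q := by
    intro s T hT hsT
    obtain ⟨u, -, hu, hut⟩ := hDd.exists_seq_strictAnti_tendsto_of_lt hsT
    have hc : ∀ n, Z (u n) =ᵐ[Q] Q[Z T | 𝒢 (u n)] := by
      intro n
      refine ae_eq_condExp_of_forall_setIntegral_eq (𝒢.le _) (hint T hT)
        (fun _ _ _ => (hint _ (hu n).2).integrableOn) (fun A hA _ => ?_)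
        (hZ _).aestronglyMeasurable
      exact (hm _ (hu n).2 _ hT (hu n).1.2.le A hA).symm
    have hl : ∀ ω, Tendsto (fun n => Z (u n) ω) atTop (𝓝 (Z s ω)) := fun ω =>
      (hrc ω s).tendsto.comp (tendsto_nhdsWithin_iff.2
        ⟨hut, Eventually.of_forall fun n => (hu n).1.1.le⟩)
    obtain ⟨h1, h2⟩ := L1_lim (fun n => 𝒢.le (u n)) (hint T hT) hc (Eventually.of_forall hl)
    refine ⟨h1, fun A hA => tendsto_nhds_unique ?_ (h2 A)⟩
    refine tendsto_const_nhds.congr fun n => ?_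
    exact hm _ (hu n).2 _ hT (hu n).1.2.le A (𝒢.mono (hu n).1.1.le _ hA)
  refine ⟨hZ, fun s => ?_, fun s t hst A hA => ?_⟩
  · obtain ⟨T, hT, h⟩ := hDd.exists_gt s
    exact (key s T hT h).1
  · obtain ⟨T, hT, h⟩ := hDd.exists_gt t
    rw [← (key t T hT h).2 A (𝒢.mono hst _ hA), (key s T hT (hst.trans_lt h)).2 A hA]

end NLSP

namespace NLSP

section P3

variable {F : Type*} [TopologicalSpace F]

theorem canonicalSig_mono : Monotone (canonicalSig F) := fun _ _ h =>
  biSup_mono fun _ hs => le_trans (show _ ≤ _ from hs) h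

theorem canonicalSig_le [m0 : MeasurableSpace C(ℝ≥0, F)] [BorelSpace C(ℝ≥0, F)] (s : ℝ≥0) :
    canonicalSig F s ≤ m0 := by
  let _ : MeasurableSpace F := borel F
  have : BorelSpace F := ⟨rfl⟩
  refine iSup₂_le fun u _ => ?_
  have : Measurable (fun ω : C(ℝ≥0, F) => ω u) :=
    (continuous_eval_const u).measurable
  exact this.comap_le

def canF (F : Type*) [TopologicalSpace F] [m0 : MeasurableSpace C(ℝ≥0, F)]
    [BorelSpace C(ℝ≥0, F)] : Filtration ℝ≥0 m0 :=
  ⟨canonicalSig F, canonicalSig_mono, canonicalSig_le⟩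

theorem cgen [PolishSpace F] (s : ℝ≥0) : ∃ b : Set (Set C(ℝ≥0, F)), b.Countable ∧
    canonicalSig F s = MeasurableSpace.generateFrom b ∧ IsPiSystem b ∧ univ ∈ b := by
  let _ : MeasurableSpace F := borel F
  have : BorelSpace F := ⟨rfl⟩
  let d := TopologicalSpace.denseSeq ℝ≥0
  let b0 : Set (Set C(ℝ≥0, F)) :=
    ⋃ n, (fun U => (fun ω : C(ℝ≥0, F) => ω (min (d n) s)) ⁻¹' U) ''
      TopologicalSpace.countableBasis F
  have hb0c : b0.Countable :=
    countable_iUnion fun n => (TopologicalSpace.countable_countableBasis F).image _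
  have hb0 : canonicalSig F s = MeasurableSpace.generateFrom b0 := by
    apply le_antisymm
    · refine iSup₂_le fun u hu => ?_
      have hu : u ≤ s := hu
      have hm : ∀ n, Measurable[MeasurableSpace.generateFrom b0]
          (fun ω : C(ℝ≥0, F) => ω (min (d n) s)) := by
        intro n
        have hbo : (borel F) = _ :=
          (TopologicalSpace.isBasis_countableBasis F).borel_eq_generateFrom
        change @Measurable _ _ (MeasurableSpace.generateFrom b0) (borel F) _
        rw [hbo]
        refine @measurable_generateFrom _ _ (MeasurableSpace.generateFrom b0) _ _ fun U hU => ?_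
        exact MeasurableSpace.measurableSet_generateFrom
          (mem_iUnion.2 ⟨n, mem_image_of_mem _ hU⟩)
      obtain ⟨x, hx, hxl⟩ := mem_closure_iff_seq_limit.1
        (TopologicalSpace.denseRange_denseSeq ℝ≥0 u)
      choose k hk using hx
      have : Measurable[MeasurableSpace.generateFrom b0] (fun ω : C(ℝ≥0, F) => ω u) := by
        let _ := TopologicalSpace.upgradeIsCompletelyMetrizable F
        refine @measurable_of_tendsto_metrizable _ _ (MeasurableSpace.generateFrom b0) _ _ _ _
          (fun n (ω : C(ℝ≥0, F)) => ω (min (d (k n)) s)) _ (fun n => hm (k n)) ?_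
        rw [tendsto_pi_nhds]
        intro ω
        refine (ω.continuous.tendsto u).comp ?_
        have h1 : Tendsto (fun n => min (x n) s) atTop (𝓝 (min u s)) :=
          hxl.min tendsto_const_nhds
        rw [min_eq_left hu] at h1
        refine h1.congr fun n => ?_
        rw [← hk n]
      exact this.comap_le
    · refine MeasurableSpace.generateFrom_le ?_
      rintro _ h
      obtain ⟨n, U, hU, rfl⟩ := mem_iUnion.1 h
      have hle : MeasurableSpace.comap (fun ω : C(ℝ≥0, F) => ω (min (d n) s)) (borel F)
          ≤ canonicalSig F s :=
        le_iSup₂_of_le (min (d n) s) (show min (d n) s ≤ s from min_le_right _ _) le_rfl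
      refine hle _ ⟨U, ?_, rfl⟩
      exact (TopologicalSpace.isOpen_of_mem_countableBasis hU).measurableSet
  refine ⟨generateSetAlgebra b0, countable_generateSetAlgebra hb0c, ?_, ?_, ?_⟩
  · rw [generateFrom_generateSetAlgebra_eq, hb0]
  · intro A hA B hB _
    exact isSetAlgebra_generateSetAlgebra.inter_mem hA hB
  · exact isSetAlgebra_generateSetAlgebra.univ_mem

variable [m0 : MeasurableSpace C(ℝ≥0, F)]

theorem ftau_le (τ : C(ℝ≥0, F) → ℝ≥0) : ftau τ ≤ m0 :=
  MeasurableSpace.generateFrom_le fun _ h => h.1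

theorem ftau_inter {τ : C(ℝ≥0, F) → ℝ≥0} (hτ : IsStoppingTimeOn (canonicalSig F) τ)
    {B : Set C(ℝ≥0, F)} (hB : MeasurableSet[ftau τ] B) (u : ℝ≥0) :
    MeasurableSet[canonicalSig F u] (B ∩ {ω | τ ω ≤ u}) := by
  induction B, hB using MeasurableSpace.generateFrom_induction with
  | hC t ht _ => exact ht.2 u
  | empty => rw [empty_inter]; exact @MeasurableSet.empty _ (canonicalSig F u)
  | compl t _ ih =>
    have : tᶜ ∩ {ω | τ ω ≤ u} = {ω | τ ω ≤ u} \ (t ∩ {ω | τ ω ≤ u}) := by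
      ext ω; simp only [mem_inter_iff, mem_compl_iff, Set.mem_sdiff]; tauto
    rw [this]
    exact @MeasurableSet.diff _ (canonicalSig F u) _ _ (hτ u) ih
  | iUnion f _ ih =>
    rw [iUnion_inter]
    exact @MeasurableSet.iUnion _ _ (canonicalSig F u) _ _ ih

theorem ftau_tau [BorelSpace C(ℝ≥0, F)] {τ : C(ℝ≥0, F) → ℝ≥0} (hτ : IsStoppingTimeOn (canonicalSig F) τ) (q : ℝ≥0) :
    MeasurableSet[ftau τ] {ω | τ ω ≤ q} := by
  refine MeasurableSpace.measurableSet_generateFrom ⟨canonicalSig_le q _ (hτ q), fun t => ?_⟩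
  have : {ω | τ ω ≤ q} ∩ {ω | τ ω ≤ t} = {ω | τ ω ≤ min q t} := by
    ext ω; simp
  rw [this]
  exact canonicalSig_mono (min_le_right q t) _ (hτ _)

end P3

theorem rc_min {f : ℝ≥0 → ℝ} (hf : ∀ s, ContinuousWithinAt f (Set.Ici s) s) (c s : ℝ≥0) :
    ContinuousWithinAt (fun r => f r - f (min r c)) (Set.Ici s) s := by
  refine (hf s).sub ?_
  have h := hf (min s c)
  exact ContinuousWithinAt.comp (g := f) (f := fun r => min r c) (t := Ici (min s c)) h
    (by fun_prop) (fun r hr => min_le_min_right c hr)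

end NLSP
namespace NLSP

/-- **Conditional martingale property after a stopping time**: if `(M_s − M_{s ∧ t*})` is a
`P`-martingale and `τ ≥ t*` is a finite stopping time, then there is a `P`-null set `N` such
that for every `ω ∉ N` the process `(M_s − M_{s ∧ τ(ω)})` is a martingale under (any version
of) the regular conditional probability `P(·|𝓕_τ)(ω)`. -/
theorem conditional_martingale_after_stopping_time
    {F : Type*} [TopologicalSpace F] [PolishSpace F]
    [MeasurableSpace C(ℝ≥0, F)] [BorelSpace C(ℝ≥0, F)]
    (P : Measure C(ℝ≥0, F)) [IsProbabilityMeasure P]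
    (tstar : ℝ≥0)
    (τ : C(ℝ≥0, F) → ℝ≥0) (hτ : IsStoppingTimeOn (canonicalSig F) τ)
    (hτt : ∀ ω, tstar ≤ τ ω)
    (M : ℝ≥0 → C(ℝ≥0, F) → ℝ)
    (hMadapted : ∀ s, Measurable[canonicalSig F s] (M s))
    (hMrc : ∀ ω : C(ℝ≥0, F), ∀ s : ℝ≥0,
      ContinuousWithinAt (fun r => M r ω) (Set.Ici s) s)
    (hmart : IsMartingaleOn P (canonicalSig F) fun s ω => M s ω - M (min s tstar) ω)
    (κ : C(ℝ≥0, F) → Measure C(ℝ≥0, F)) (hκ : IsRCP P τ κ) :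
    ∃ N : Set C(ℝ≥0, F), MeasurableSet N ∧ P N = 0 ∧
      ∀ ω ∉ N, IsMartingaleOn (κ ω) (canonicalSig F)
        fun s ω' => M s ω' - M (min s (τ ω)) ω' := by
  classical
  set Y : ℝ≥0 → C(ℝ≥0, F) → ℝ := fun s ω => M s ω - M (min s tstar) ω with hYdef
  obtain ⟨hY1, hY2, hY3⟩ := hmart
  have hY : Martingale Y (canF F) P := by
    refine ⟨hY1, fun s t hst => ?_⟩
    refine (ae_eq_condExp_of_forall_setIntegral_eq ((canF F).le s) (hY2 t)
      (fun _ _ _ => (hY2 s).integrableOn) (fun A hA _ => ?_)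
      (hY1 s).aestronglyMeasurable).symm
    exact (hY3 s t hst A hA).symm
  have hrc : ∀ ω s, ContinuousWithinAt (fun r => Y r ω) (Set.Ici s) s :=
    fun ω s => rc_min (hMrc ω) tstar s
  obtain ⟨hp, hmeas, hdis⟩ := hκ
  obtain ⟨D, hDc, hDd⟩ := TopologicalSpace.exists_countable_dense ℝ≥0
  choose b hbc hbg hbpi hbu using cgen (F := F)
  -- the stopped difference
  let W : ℝ≥0 → C(ℝ≥0, F) → ℝ := fun s ω => Y s ω - Y (min s (τ ω)) ω
  have hWM : ∀ s ω, W s ω = M s ω - M (min s (τ ω)) ω := by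
    intro s ω
    have : min (min s (τ ω)) tstar = min s tstar := by
      rw [min_assoc, min_eq_right (hτt ω)]
    simp only [W, hYdef, this]
    ring
  have hWm : ∀ s, Measurable (W s) := fun s =>
    ((hY1 s).mono (canonicalSig_le s)).measurable.sub (opt_stop (canF F) Y hY hrc τ hτ s).1
  have hWi : ∀ s, Integrable (W s) P := fun s =>
    (hY2 s).sub (opt_stop (canF F) Y hY hrc τ hτ s).2.1
  have a1 : ∀ᵐ ω ∂P, ∀ᵐ ω' ∂(κ ω), τ ω' = τ ω :=
    tau_const (ftau_le τ) κ hmeas hdis τ (ftau_tau hτ) D hDc hDd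
  have a2 : ∀ᵐ ω ∂P, ∀ q ∈ D, Integrable (W q) (κ ω) := by
    rw [ae_ball_iff hDc]
    intro q _
    exact (rcp_aux (ftau_le τ) κ hp hmeas hdis (W q) (hWm q).stronglyMeasurable (hWi q)).1
  have a3 : ∀ᵐ ω ∂P, ∀ s ∈ D, ∀ t ∈ D, ∀ A ∈ b s, s ≤ t →
      ∫ ω' in A, (W t ω' - W s ω') ∂(κ ω) = 0 := by
    rw [ae_ball_iff hDc]
    intro s _
    rw [ae_ball_iff hDc]
    intro t _
    rw [ae_ball_iff (hbc s)]
    intro A hA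
    by_cases hst : s ≤ t
    · have hAs : MeasurableSet[canonicalSig F s] A := by
        rw [hbg s]; exact MeasurableSpace.measurableSet_generateFrom hA
      have hAm : MeasurableSet A := canonicalSig_le s _ hAs
      have hi := (hWi t).sub (hWi s)
      have := (rcp_aux (ftau_le τ) κ hp hmeas hdis (A.indicator (W t - W s))
        (((hWm t).sub (hWm s)).indicator hAm).stronglyMeasurable (hi.indicator hAm)).2 ?_
      · filter_upwards [this] with ω hω _
        rw [integral_indicator hAm] at hω
        exact hω
      · intro B hB
        have hBm : MeasurableSet B := ftau_le τ _ hB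
        rw [integral_indicator hAm, Measure.restrict_restrict hAm]
        have := cond_incr (canF F) Y hY hrc τ hτ s t hst A B hAs hBm (ftau_inter hτ hB)
        simp only [Pi.sub_apply]
        rw [integral_sub (hWi t).integrableOn (hWi s).integrableOn, sub_eq_zero]
        exact this
    · exact Eventually.of_forall fun _ h => absurd h hst
  have hall : ∀ᵐ ω ∂P, IsMartingaleOn (κ ω) (canonicalSig F)
        fun s ω' => M s ω' - M (min s (τ ω)) ω' := by
    filter_upwards [a1, a2, a3] with ω h1 h2 h3
    have := hp ω
    have hZW : ∀ s, W s =ᵐ[κ ω] fun ω' => M s ω' - M (min s (τ ω)) ω' := by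
      intro s
      filter_upwards [h1] with ω' h'
      rw [hWM, h']
    refine mart_of_dense (κ ω) (canF F) _ (fun s => ?_) (fun ω' s => rc_min (hMrc ω') _ s)
      D hDd (fun q hq => (h2 q hq).congr (hZW q)) (fun s hs t ht hst A hA => ?_)
    · exact (hMadapted s).stronglyMeasurable.sub
        ((hMadapted _).stronglyMeasurable.mono (canonicalSig_mono (min_le_left _ _)))
    · have hz := zero_on_sigma (ν := κ ω) (canonicalSig_le s) (hbg s) (hbpi s) (hbu s)
        ((h2 t ht).sub (h2 s hs)) (fun A hA => h3 s hs t ht A hA hst) A hA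
      simp only [Pi.sub_apply] at hz
      rw [integral_sub (h2 t ht).integrableOn (h2 s hs).integrableOn, sub_eq_zero] at hz
      rw [← integral_congr_ae (ae_restrict_of_ae (hZW t)),
        ← integral_congr_ae (ae_restrict_of_ae (hZW s))]
      exact hz
  obtain ⟨N, hsub, hNm, hN0⟩ := exists_measurable_superset_of_null (ae_iff.1 hall)
  exact ⟨N, hNm, hN0, fun ω hω => not_not.1 fun h => hω (hsub h)⟩

end NLSP
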